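/- arXiv:2006.16853 — 3 statements merged into one kernel-verified Lean document; each statement's English description precedes it below -/
import Mathlib

section
/- Let C ≥ 0, let U ⊆ (0,1)^e and V ⊆ (0,1)^d be open sets, let g : U → ℝ^d be a smooth map with g(U) ⊆ V each of whose component functions is (A_g, B_g, C)-mild, and let f : V → ℝ be (A_f, B_f, C)-mild. Then the composition f ∘ g : U → ℝ is C-mild, i.e., there exist A, B > 0 such that f ∘ g is (A, B, C)-mild. -/
open Real Set

/-- The partial derivative `∂f/∂xᵢ`. -/
noncomputable def pDeriv {m : ℕ} (i : Fin m) (f : (Fin m → ℝ) → ℝ) : (Fin m → ℝ) → ℝ :=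
  fun x => fderiv ℝ f x (Pi.single i 1)

/-- The iterated partial derivative `f⁽ᵛ⁾ = ∂^|ν| f / ∂x₁^ν₁ ⋯ ∂x_m^ν_m`. -/
noncomputable def mDeriv {m : ℕ} (ν : Fin m → ℕ) (f : (Fin m → ℝ) → ℝ) : (Fin m → ℝ) → ℝ :=
  (List.finRange m).foldr (fun i g => (pDeriv i)^[ν i] g) f

/-- A function `f` is `(A,B,C)`-mild on an open set `U ⊆ (0,1)^m`:
`f` is `C^∞` on `U` and `|f⁽ᵛ⁾(x)| ≤ B A^|ν| (|ν|!)^(C+1)` for all `x ∈ U`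
and multi-indices `ν ∈ ℕ^m`. -/
def IsMildM {m : ℕ} (U : Set (Fin m → ℝ)) (f : (Fin m → ℝ) → ℝ) (A B C : ℝ) : Prop :=
  ContDiffOn ℝ (⊤ : ℕ∞) f U ∧
    ∀ x ∈ U, ∀ ν : Fin m → ℕ,
      |mDeriv ν f x| ≤ B * A ^ (∑ i, ν i) * ((∑ i, ν i).factorial : ℝ) ^ (C + 1)

/-- Iterated partial derivative along a word. -/
noncomputable def wD {m : ℕ} (l : List (Fin m)) (f : (Fin m → ℝ) → ℝ) : (Fin m → ℝ) → ℝ :=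
  l.foldr pDeriv f

/-- The canonical word attached to a multi-index. -/
def canonWord {m : ℕ} (ν : Fin m → ℕ) : List (Fin m) :=
  (List.finRange m).flatMap (fun i => List.replicate (ν i) i)

lemma wD_replicate {m : ℕ} (k : ℕ) (i : Fin m) (f : (Fin m → ℝ) → ℝ) :
    wD (List.replicate k i) f = (pDeriv i)^[k] f := by
  induction k with
  | zero => rfl
  | succ k ih => 
    rw [Function.iterate_succ_apply', ← ih]; rfl

lemma mDeriv_eq_wD {m : ℕ} (ν : Fin m → ℕ) (f : (Fin m → ℝ) → ℝ) :
    mDeriv ν f = wD (canonWord ν) f := by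
  unfold mDeriv canonWord
  induction List.finRange m with
  | nil => rfl
  | cons a l ih =>
    rw [List.foldr_cons, ih, List.flatMap_cons, ← wD_replicate]
    simp [wD, List.foldr_append]

lemma length_canonWord {m : ℕ} (ν : Fin m → ℕ) : (canonWord ν).length = ∑ i, ν i := by
  simp [canonWord, List.length_flatMap, Fin.sum_univ_def]

lemma perm_canonWord {m : ℕ} (l : List (Fin m)) :
    l.Perm (canonWord (fun i => l.count i)) := by
  rw [List.perm_iff_count]
  intro a
  simp only [canonWord, List.count_flatMap, Function.comp_def, List.count_replicate]
  rw [← Fin.sum_univ_def (fun i => if i == a then l.count i else 0)]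
  simp

lemma pDeriv_smooth {m : ℕ} {U : Set (Fin m → ℝ)} (hU : IsOpen U) {f : (Fin m → ℝ) → ℝ}
    (hf : ContDiffOn ℝ (⊤ : ℕ∞) f U) (i : Fin m) : ContDiffOn ℝ (⊤ : ℕ∞) (pDeriv i f) U := by
  have h := hf.fderiv_of_isOpen hU (m := ((⊤ : ℕ∞) : WithTop ℕ∞)) (by simp)
  exact h.clm_apply contDiffOn_const

lemma wD_smooth {m : ℕ} {U : Set (Fin m → ℝ)} (hU : IsOpen U) {f : (Fin m → ℝ) → ℝ}
    (hf : ContDiffOn ℝ (⊤ : ℕ∞) f U) (l : List (Fin m)) :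
    ContDiffOn ℝ (⊤ : ℕ∞) (wD l f) U := by
  induction l with
  | nil => exact hf
  | cons a l ih => exact pDeriv_smooth hU ih a

lemma pDeriv_congr {m : ℕ} {U : Set (Fin m → ℝ)} (hU : IsOpen U) {f g : (Fin m → ℝ) → ℝ}
    (h : EqOn f g U) (i : Fin m) : EqOn (pDeriv i f) (pDeriv i g) U := by
  intro x hx
  have : f =ᶠ[nhds x] g := h.eventuallyEq_of_mem (hU.mem_nhds hx)
  simp only [pDeriv, this.fderiv_eq]

lemma pDeriv_comm {m : ℕ} {U : Set (Fin m → ℝ)} (hU : IsOpen U) {f : (Fin m → ℝ) → ℝ}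
    (hf : ContDiffOn ℝ (⊤ : ℕ∞) f U) (i j : Fin m) :
    EqOn (pDeriv i (pDeriv j f)) (pDeriv j (pDeriv i f)) U := by
  intro x hx
  have hfx : ContDiffAt ℝ (⊤ : ℕ∞) f x := hf.contDiffAt (hU.mem_nhds hx)
  have hs : IsSymmSndFDerivAt ℝ f x := hfx.isSymmSndFDerivAt (by
    simp only [minSmoothness_of_isRCLikeNormedField]
    exact WithTop.coe_le_coe.2 (OrderTop.le_top _))
  have hd : DifferentiableAt ℝ (fderiv ℝ f) x := by
    have h := hf.fderiv_of_isOpen hU (m := ((⊤ : ℕ∞) : WithTop ℕ∞)) (by simp)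
    exact (h.contDiffAt (hU.mem_nhds hx)).differentiableAt (by simp)
  have key : ∀ v w, fderiv ℝ (fun y => fderiv ℝ f y v) x w = fderiv ℝ (fderiv ℝ f) x w v := by
    intro v w
    rw [fderiv_clm_apply hd (differentiableAt_const v)]
    simp
  exact (key _ _).trans ((hs _ _).trans (key _ _).symm)

lemma wD_perm {m : ℕ} {U : Set (Fin m → ℝ)} (hU : IsOpen U) {f : (Fin m → ℝ) → ℝ}
    (hf : ContDiffOn ℝ (⊤ : ℕ∞) f U) {l l' : List (Fin m)} (h : l.Perm l') :
    EqOn (wD l f) (wD l' f) U := by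
  induction h with
  | nil => exact fun _ _ => rfl
  | cons a _ ih => exact pDeriv_congr hU ih a
  | swap a b l => exact pDeriv_comm hU (wD_smooth hU hf l) _ _
  | trans _ _ h1 h2 => exact h1.trans h2

lemma iteratedFDeriv_eq_wD {m : ℕ} {U : Set (Fin m → ℝ)} (hU : IsOpen U)
    {f : (Fin m → ℝ) → ℝ} (hf : ContDiffOn ℝ (⊤ : ℕ∞) f U) (n : ℕ) (r : Fin n → Fin m) :
    EqOn (fun x => iteratedFDeriv ℝ n f x (fun j => Pi.single (r j) 1))
      (wD (List.ofFn r) f) U := by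
  induction n with
  | zero => intro x hx; simp [wD]
  | succ n ih =>
    intro x hx
    have hfx : ContDiffAt ℝ (⊤ : ℕ∞) f x := hf.contDiffAt (hU.mem_nhds hx)
    have hd : DifferentiableAt ℝ (iteratedFDeriv ℝ n f) x :=
      hfx.differentiableAt_iteratedFDeriv (by exact_mod_cast ENat.natCast_lt_top n)
    simp only []
    rw [hd.iteratedFDeriv_succ_apply_left', List.ofFn_succ]
    exact pDeriv_congr hU (ih (fun j => r j.succ)) (r 0) hx

/-- Partial derivative bounds follow from bounds on the iterated Fréchet derivative. -/
lemma abs_mDeriv_le {m : ℕ} {U : Set (Fin m → ℝ)} (hU : IsOpen U)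
    {f : (Fin m → ℝ) → ℝ} (hf : ContDiffOn ℝ (⊤ : ℕ∞) f U) (ν : Fin m → ℕ)
    {x : Fin m → ℝ} (hx : x ∈ U) :
    |mDeriv ν f x| ≤ ‖iteratedFDeriv ℝ (∑ i, ν i) f x‖ := by
  rw [← length_canonWord, mDeriv_eq_wD]
  have h := iteratedFDeriv_eq_wD hU hf _ (canonWord ν).get hx
  rw [List.ofFn_get] at h
  rw [← h, ← Real.norm_eq_abs]
  refine (ContinuousMultilinearMap.le_opNorm _ _).trans ?_
  simp [Pi.norm_single]

/-- Conversely the Fréchet derivatives are bounded by the partial derivatives. -/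
lemma norm_iteratedFDeriv_le_of_mDeriv {m : ℕ} {U : Set (Fin m → ℝ)} (hU : IsOpen U)
    {f : (Fin m → ℝ) → ℝ} (hf : ContDiffOn ℝ (⊤ : ℕ∞) f U) (n : ℕ) (M : ℝ)
    {x : Fin m → ℝ} (hx : x ∈ U) (hM : 0 ≤ M)
    (h : ∀ ν : Fin m → ℕ, ∑ i, ν i = n → |mDeriv ν f x| ≤ M) :
    ‖iteratedFDeriv ℝ n f x‖ ≤ (m : ℝ) ^ n * M := by
  refine ContinuousMultilinearMap.opNorm_le_bound (by positivity) fun v => ?_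
  have hv : v = fun j => ∑ i, (v j i) • (Pi.single i (1:ℝ) : Fin m → ℝ) := by
    funext j
    exact (pi_eq_sum_univ' (v j)).trans (by simp)
  conv_lhs => rw [hv]
  have e := (iteratedFDeriv ℝ n f x).toMultilinearMap.map_sum
    (fun j i => (v j i) • (Pi.single i (1:ℝ) : Fin m → ℝ))
  simp only [ContinuousMultilinearMap.coe_coe] at e
  rw [e]
  refine (norm_sum_le _ _).trans ?_
  have : ∀ r ∈ (Finset.univ : Finset (Fin n → Fin m)),
      ‖iteratedFDeriv ℝ n f x (fun j => (v j (r j)) • (Pi.single (r j) (1:ℝ) : Fin m → ℝ))‖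
        ≤ M * ∏ j, ‖v j‖ := by
    intro r _
    rw [ContinuousMultilinearMap.map_smul_univ, norm_smul, mul_comm]
    refine mul_le_mul ?_ ?_ (norm_nonneg _) hM
    · have h1 := iteratedFDeriv_eq_wD hU hf n r hx
      simp only at h1
      rw [h1, wD_perm hU hf (perm_canonWord (List.ofFn r)) hx, ← mDeriv_eq_wD]
      refine h _ ?_
      rw [← length_canonWord, ← (perm_canonWord (List.ofFn r)).length_eq, List.length_ofFn]
    · rw [norm_prod]
      exact Finset.prod_le_prod (fun _ _ => norm_nonneg _) (fun j _ => norm_le_pi_norm _ _)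
  refine (Finset.sum_le_sum this).trans ?_
  simp [mul_assoc]

open OrderedFinpartition in
/-- `k! ∏ |p_i|!` for an ordered finpartition. -/
def pw {n : ℕ} (c : OrderedFinpartition n) : ℕ :=
  c.length.factorial * ∏ i, (c.partSize i).factorial

lemma pw_none {n : ℕ} (c : OrderedFinpartition n) :
    pw (c.extend none) = (c.length + 1) * pw c := by
  have : pw (c.extend none) = (c.length + 1).factorial *
      ∏ i : Fin (c.length + 1), ((Fin.cons 1 c.partSize : Fin (c.length + 1) → ℕ) i).factorial := rfl
  rw [this, Fin.prod_univ_succ, Nat.factorial_succ, pw]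
  simp [mul_assoc]

lemma pw_some {n : ℕ} (c : OrderedFinpartition n) (k : Fin c.length) :
    pw (c.extend (some k)) = (c.partSize k + 1) * pw c := by
  have : pw (c.extend (some k)) = c.length.factorial *
      ∏ i : Fin c.length, (Function.update c.partSize k (c.partSize k + 1) i).factorial := rfl
  rw [this, pw, ← Finset.mul_prod_erase _ _ (Finset.mem_univ k),
    ← Finset.mul_prod_erase _ (fun i => (c.partSize i).factorial) (Finset.mem_univ k)]
  have : ∏ i ∈ Finset.univ.erase k,
      (Function.update c.partSize k (c.partSize k + 1) i).factorial
      = ∏ i ∈ Finset.univ.erase k, (c.partSize i).factorial :=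
    Finset.prod_congr rfl (fun i hi => by rw [Function.update_of_ne (Finset.ne_of_mem_erase hi)])
  rw [this, Function.update_self, Nat.factorial_succ]
  ring

lemma length_none {n : ℕ} (c : OrderedFinpartition n) :
    (c.extend none).length = c.length + 1 := rfl

lemma length_some {n : ℕ} (c : OrderedFinpartition n) (k : Fin c.length) :
    (c.extend (some k)).length = c.length := rfl

lemma sum_partSize {n : ℕ} (c : OrderedFinpartition n) : ∑ i, c.partSize i = n := by
  have := c.sum_sigma_eq_sum (fun _ => 1)
  simpa using this

lemma pw_le {n : ℕ} (c : OrderedFinpartition n) : pw c ≤ n.factorial := by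
  induction n with
  | zero =>
    obtain rfl : c = default := Subsingleton.elim _ _
    simp [pw]
  | succ n ih =>
    obtain ⟨⟨c, o⟩, rfl⟩ := (OrderedFinpartition.extendEquiv n).surjective c
    change pw (c.extend o) ≤ _
    rw [Nat.factorial_succ]
    cases o with
    | none =>
      rw [pw_none]
      exact Nat.mul_le_mul (by have := c.length_le; omega) (ih c)
    | some k =>
      rw [pw_some]
      exact Nat.mul_le_mul (by have := c.partSize_le k; omega) (ih c)

lemma sum_pw_le (X : ℝ) (hX : 0 ≤ X) (n : ℕ) :
    ∑ c : OrderedFinpartition n, X ^ c.length * (pw c : ℝ) ≤ n.factorial * (X + 2) ^ n := by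
  induction n with
  | zero => simp [pw]
  | succ n ih =>
    rw [← (OrderedFinpartition.extendEquiv n).sum_comp, Fintype.sum_sigma]
    have : ∀ c ∈ (Finset.univ : Finset (OrderedFinpartition n)),
        ∑ o : Option (Fin c.length), X ^ ((OrderedFinpartition.extendEquiv n) ⟨c, o⟩).length *
          (pw ((OrderedFinpartition.extendEquiv n) ⟨c, o⟩) : ℝ)
        ≤ (X ^ c.length * (pw c : ℝ)) * ((n + 1) * (X + 2)) := by
      intro c _
      change ∑ o : Option (Fin c.length), X ^ (c.extend o).length * (pw (c.extend o) : ℝ) ≤ _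
      rw [Fintype.sum_option, length_none, pw_none]
      have h2 : ∀ k : Fin c.length, X ^ (c.extend (some k)).length * (pw (c.extend (some k)) : ℝ)
          = (X ^ c.length * (pw c : ℝ)) * (c.partSize k + 1) := by
        intro k
        rw [pw_some, length_some]; push_cast; ring
      rw [Finset.sum_congr rfl (fun k _ => h2 k), ← Finset.mul_sum, Finset.sum_add_distrib]
      have h3 : (∑ k, (c.partSize k : ℝ)) = n := by exact_mod_cast sum_partSize c
      rw [h3]
      have h4 : (c.length : ℝ) ≤ n := by exact_mod_cast c.length_le
      have h5 : 0 ≤ X ^ c.length * (pw c : ℝ) := by positivity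
      have h6 : X ^ (c.length + 1) * (((c.length + 1) * pw c : ℕ) : ℝ)
          = (X ^ c.length * (pw c : ℝ)) * (X * (c.length + 1)) := by push_cast; ring
      rw [h6, ← mul_add]
      refine mul_le_mul_of_nonneg_left ?_ h5
      simp
      nlinarith
    refine (Finset.sum_le_sum this).trans ?_
    rw [← Finset.sum_mul, Nat.factorial_succ]
    refine (mul_le_mul_of_nonneg_right ih (by positivity)).trans (le_of_eq ?_)
    push_cast; ring

/-- Bound for a single term of the Faà di Bruno formula, summed. -/
lemma faa_bound (C : ℝ) (hC : 0 ≤ C) (a b a' b' : ℝ) (ha : 0 ≤ a) (hb : 0 ≤ b) (ha' : 0 ≤ a')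
    (hb' : 0 ≤ b') (n : ℕ) :
    ∑ c : OrderedFinpartition n, (b * a ^ c.length * (c.length.factorial : ℝ) ^ (C + 1)) *
      ∏ i, (b' * a' ^ (c.partSize i) * ((c.partSize i).factorial : ℝ) ^ (C + 1))
    ≤ b * (a' * (a * b' + 2)) ^ n * (n.factorial : ℝ) ^ (C + 1) := by
  have key : ∀ c ∈ (Finset.univ : Finset (OrderedFinpartition n)),
      (b * a ^ c.length * (c.length.factorial : ℝ) ^ (C + 1)) *
        ∏ i, (b' * a' ^ (c.partSize i) * ((c.partSize i).factorial : ℝ) ^ (C + 1))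
      ≤ (b * a' ^ n * (n.factorial : ℝ) ^ C) * ((a * b') ^ c.length * (pw c : ℝ)) := by
    intro c _
    rw [Finset.prod_mul_distrib, Finset.prod_mul_distrib, Finset.prod_pow_eq_pow_sum, sum_partSize,
      Real.finsetProd_rpow _ _ (fun i _ => by positivity)]
    have h1 : (c.length.factorial : ℝ) ^ (C + 1) * (∏ i, ((c.partSize i).factorial : ℝ)) ^ (C + 1)
        = (pw c : ℝ) ^ (C + 1) := by
      rw [← Real.mul_rpow (by positivity) (by positivity)]
      simp [pw]
    have hp : (0:ℝ) < pw c := by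
      have : 0 < pw c := by unfold pw; positivity
      exact_mod_cast this
    have h2 : (pw c : ℝ) ^ (C + 1) ≤ (n.factorial : ℝ) ^ C * pw c := by
      rw [Real.rpow_add_one hp.ne']
      refine mul_le_mul_of_nonneg_right ?_ hp.le
      exact Real.rpow_le_rpow hp.le (by exact_mod_cast pw_le c) hC
    simp only [Finset.prod_const, Finset.card_univ, Fintype.card_fin]
    calc _ = (b * a' ^ n * (a * b') ^ c.length) * ((c.length.factorial : ℝ) ^ (C + 1) *
            (∏ i, ((c.partSize i).factorial : ℝ)) ^ (C + 1)) := by rw [mul_pow]; ring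
      _ ≤ (b * a' ^ n * (a * b') ^ c.length) * ((n.factorial : ℝ) ^ C * pw c) := by
          rw [h1]; exact mul_le_mul_of_nonneg_left h2 (by positivity)
      _ = _ := by ring
  refine (Finset.sum_le_sum key).trans ?_
  rw [← Finset.mul_sum]
  refine (mul_le_mul_of_nonneg_left (sum_pw_le (a * b') (by positivity) n)
    (by positivity)).trans (le_of_eq ?_)
  rw [Real.rpow_add_one (by positivity), mul_pow]
  ring

theorem stmt1 {e d : ℕ} (C : ℝ) (hC : 0 ≤ C)
    (U : Set (Fin e → ℝ)) (V : Set (Fin d → ℝ)) (hUo : IsOpen U) (hVo : IsOpen V)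
    (hU : U ⊆ univ.pi fun _ : Fin e => Ioo (0:ℝ) 1)
    (hV : V ⊆ univ.pi fun _ : Fin d => Ioo (0:ℝ) 1)
    (g : (Fin e → ℝ) → Fin d → ℝ) (f : (Fin d → ℝ) → ℝ)
    (Ag Bg Af Bf : ℝ) (hAg : 0 < Ag) (hBg : 0 < Bg) (hAf : 0 < Af) (hBf : 0 < Bf)
    (hg : ∀ i : Fin d, IsMildM U (fun x => g x i) Ag Bg C)
    (hgV : ∀ x ∈ U, g x ∈ V)
    (hf : IsMildM V f Af Bf C) :
    ∃ A B : ℝ, 0 < A ∧ 0 < B ∧ IsMildM U (fun x => f (g x)) A B C := by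
  have hgs : ContDiffOn ℝ (⊤ : ℕ∞) g U := contDiffOn_pi.2 fun i => (hg i).1
  have hcs : ContDiffOn ℝ (⊤ : ℕ∞) (fun x => f (g x)) U := hf.1.comp hgs hgV
  have hAe : 0 < ((e:ℝ) + 1) * Ag := by positivity
  refine ⟨(((e:ℝ) + 1) * Ag) * ((d * Af) * Bg + 2), Bf, by positivity, hBf, hcs, ?_⟩
  intro x hx ν
  refine (abs_mDeriv_le hUo hcs ν hx).trans ?_
  generalize (∑ i, ν i) = n
  have hgx : ContDiffAt ℝ (⊤ : ℕ∞) g x := hgs.contDiffAt (hUo.mem_nhds hx)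
  have hfx : ContDiffAt ℝ (⊤ : ℕ∞) f (g x) := hf.1.contDiffAt (hVo.mem_nhds (hgV x hx))
  have bf : ∀ k, ‖iteratedFDeriv ℝ k f (g x)‖ ≤
      Bf * (d * Af) ^ k * (k.factorial : ℝ) ^ (C + 1) := by
    intro k
    refine (norm_iteratedFDeriv_le_of_mDeriv hVo hf.1 k
      (Bf * Af ^ k * (k.factorial : ℝ) ^ (C + 1)) (hgV x hx) (by positivity) ?_).trans
      (le_of_eq (by rw [mul_pow]; ring))
    rintro ν rfl
    exact hf.2 _ (hgV x hx) ν
  have bg : ∀ k, ‖iteratedFDeriv ℝ k g x‖ ≤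
      Bg * (((e:ℝ) + 1) * Ag) ^ k * (k.factorial : ℝ) ^ (C + 1) := by
    intro k
    refine ContinuousMultilinearMap.opNorm_le_bound (by positivity) fun v => ?_
    refine (pi_norm_le_iff_of_nonneg (by positivity)).2 fun i => ?_
    have h1 := (ContinuousLinearMap.proj (R := ℝ) (φ := fun _ : Fin d => ℝ) i).iteratedFDeriv_comp_left
      hgx (i := k) (by exact_mod_cast (OrderTop.le_top (k : ℕ∞)))
    have h2 : iteratedFDeriv ℝ k g x v i = iteratedFDeriv ℝ k (fun y => g y i) x v := by
      have := congrArg (fun T => T v) h1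
      exact this.symm
    rw [h2]
    refine (ContinuousMultilinearMap.le_opNorm _ _).trans
      (mul_le_mul_of_nonneg_right ?_ (by positivity))
    refine (norm_iteratedFDeriv_le_of_mDeriv hUo (hg i).1 k
      (Bg * Ag ^ k * (k.factorial : ℝ) ^ (C + 1)) hx (by positivity) ?_).trans ?_
    · rintro ν rfl
      exact (hg i).2 x hx ν
    · calc (e:ℝ) ^ k * (Bg * Ag ^ k * (k.factorial : ℝ) ^ (C + 1))
          ≤ ((e:ℝ) + 1) ^ k * (Bg * Ag ^ k * (k.factorial : ℝ) ^ (C + 1)) := by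
            gcongr; linarith
        _ = _ := by rw [mul_pow]; ring
  have hcomp := iteratedFDeriv_comp hfx hgx (i := n) (by exact_mod_cast (OrderTop.le_top (n : ℕ∞)))
  have : iteratedFDeriv ℝ n (fun x => f (g x)) x = _ := hcomp
  rw [this]
  refine (norm_sum_le _ _).trans ?_
  refine le_trans (Finset.sum_le_sum fun c _ => ?_)
    (faa_bound C hC (d * Af) Bf (((e:ℝ) + 1) * Ag) Bg (by positivity) hBf.le hAe.le hBg.le n)
  refine (c.norm_compAlongOrderedFinpartition_le _ _).trans ?_
  exact mul_le_mul (bf _) (Finset.prod_le_prod (fun _ _ => norm_nonneg _) fun i _ => bg _)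
    (by positivity) (by positivity)
end

section
/- Let α > 0 and let U ⊆ (0,1) be open. Suppose f : U → ℝ is smooth, f is weakly (A,B,0)-mild, and the derivative f' is also weakly (A,B,0)-mild. Then the composition f ∘ P_α : P_α^{-1}(U) → ℝ, where P_α(x) = exp(1 - x^{-α}), is (1 + 1/α)-mild; that is, there exist A', B' > 0 such that for every x ∈ P_α^{-1}(U) and every n ∈ ℕ, |(f ∘ P_α)^{(n)}(x)| ≤ B' (A')^n (n!)^{2 + 1/α}. -/
open Real Set

/-- A function `f` is weakly `(A,B,C)`-mild on an open set `U ⊆ (0,1)`: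
`f` is `C^∞` on `U` and `|f⁽ⁿ⁾(x)| ≤ B Aⁿ (n!)^(C+1) / xⁿ` for all `x ∈ U`, `n ∈ ℕ`. -/
def IsWeaklyMild (U : Set ℝ) (f : ℝ → ℝ) (A B C : ℝ) : Prop :=
  ContDiffOn ℝ (⊤ : ℕ∞) f U ∧
    ∀ x ∈ U, ∀ n : ℕ, |iteratedDeriv n f x| ≤ B * A ^ n * (n.factorial : ℝ) ^ (C + 1) / x ^ n

noncomputable def stmtP (α : ℝ) : ℝ → ℝ := fun t : ℝ => exp (1 - t ^ (-α))

noncomputable def stmtPhi (α : ℝ) (f : ℝ → ℝ) (k : ℕ) (p : ℝ) : ℝ → ℝ :=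
  fun t => t ^ (-p) * (iteratedDeriv k (deriv f) (stmtP α t) * (stmtP α t) ^ (k + 1))

noncomputable def stmtQ (α : ℝ) : ℕ → ℝ → ℝ
  | 0, _ => 1
  | n + 1, a => a * stmtQ α n (a + (α + 2))

lemma stmtQ_nonneg {α : ℝ} (hα : 0 < α) (n : ℕ) : ∀ a, 0 ≤ a → 0 ≤ stmtQ α n a := by
  induction n with
  | zero => intro a _; simp [stmtQ]
  | succ n ih => intro a ha; exact mul_nonneg ha (ih _ (by linarith))

lemma stmtQ_mono {α : ℝ} (hα : 0 < α) (n : ℕ) :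
    ∀ a b, 0 ≤ a → a ≤ b → stmtQ α n a ≤ stmtQ α n b := by
  induction n with
  | zero => intro a b _ _; simp [stmtQ]
  | succ n ih =>
    intro a b ha hab
    exact mul_le_mul hab (ih _ _ (by linarith) (by linarith))
      (stmtQ_nonneg hα n _ (by linarith)) (by linarith)

lemma stmtQ_eval (α : ℝ) (n : ℕ) : ∀ j : ℕ,
    stmtQ α n ((j + 1) * (α + 2)) * (j.factorial : ℝ) = (α + 2) ^ n * ((n + j).factorial : ℝ) := by
  induction n with
  | zero => intro j; simp [stmtQ]
  | succ n ih =>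
    intro j
    have h := ih (j + 1)
    rw [Nat.factorial_succ] at h
    have e : n + 1 + j = n + (j + 1) := by ring
    rw [e, pow_succ, mul_right_comm, ← h]
    have e2 : ((j : ℝ) + 1) * (α + 2) + (α + 2) = (((j + 1 : ℕ) : ℝ) + 1) * (α + 2) := by
      push_cast; ring
    simp only [stmtQ]
    rw [e2]; push_cast; ring

lemma stmt_smooth {U : Set ℝ} (hUo : IsOpen U) {g : ℝ → ℝ}
    (hg : ContDiffOn ℝ (⊤ : ℕ∞) g U) (k : ℕ) :
    ContDiffOn ℝ (⊤ : ℕ∞) (iteratedDeriv k g) U := by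
  induction k with
  | zero => simpa using hg
  | succ k ih =>
    rw [iteratedDeriv_succ]
    exact ((contDiffOn_infty_iff_deriv_of_isOpen hUo).1 ih).2

lemma stmtP_contDiffAt (α : ℝ) {x : ℝ} (hx : 0 < x) :
    ContDiffAt ℝ (⊤ : ℕ∞) (stmtP α) x := by
  unfold stmtP
  exact (contDiffAt_const.sub (contDiffAt_id.rpow_const_of_ne hx.ne')).exp

lemma stmtP_hasDerivAt (α : ℝ) {x : ℝ} (hx : 0 < x) :
    HasDerivAt (stmtP α) (α * x ^ (-α - 1) * stmtP α x) x := by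
  unfold stmtP
  have h := ((Real.hasDerivAt_rpow_const (x := x) (p := -α) (Or.inl hx.ne')).const_sub 1).exp
  convert h using 1
  ring

lemma stmtPhi_contDiffAt (α : ℝ) {U : Set ℝ} (hUo : IsOpen U) {f : ℝ → ℝ}
    (hf : ContDiffOn ℝ (⊤ : ℕ∞) (deriv f) U) (k : ℕ) (p : ℝ) {x : ℝ} (hx : 0 < x)
    (hxU : stmtP α x ∈ U) : ContDiffAt ℝ (⊤ : ℕ∞) (stmtPhi α f k p) x := by
  unfold stmtPhi
  have h1 : ContDiffAt ℝ (⊤ : ℕ∞) (fun t : ℝ => t ^ (-p)) x :=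
    contDiffAt_id.rpow_const_of_ne hx.ne'
  have h2 : ContDiffAt ℝ (⊤ : ℕ∞) (iteratedDeriv k (deriv f)) (stmtP α x) :=
    (stmt_smooth hUo hf k).contDiffAt (hUo.mem_nhds hxU)
  have h3 := stmtP_contDiffAt α hx
  exact h1.mul ((h2.comp x h3).mul (h3.pow (k + 1)))

lemma stmtPhi_hasDerivAt (α : ℝ) {U : Set ℝ} (hUo : IsOpen U) {f : ℝ → ℝ}
    (hf : ContDiffOn ℝ (⊤ : ℕ∞) (deriv f) U) (k : ℕ) (p : ℝ) {x : ℝ} (hx : 0 < x)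
    (hxU : stmtP α x ∈ U) : HasDerivAt (stmtPhi α f k p)
      ((-p) * stmtPhi α f k (p + 1) x + (α * stmtPhi α f (k + 1) (p + α + 1) x
        + (α * (k + 1)) * stmtPhi α f k (p + α + 1) x)) x := by
  have h1 : HasDerivAt (fun t : ℝ => t ^ (-p)) (-p * x ^ (-p - 1)) x :=
    Real.hasDerivAt_rpow_const (Or.inl hx.ne')
  have h2 : HasDerivAt (iteratedDeriv k (deriv f)) (iteratedDeriv (k + 1) (deriv f) (stmtP α x))
      (stmtP α x) := by
    rw [iteratedDeriv_succ]
    exact (((stmt_smooth hUo hf k).contDiffAt (hUo.mem_nhds hxU)).differentiableAt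
      (by simp)).hasDerivAt
  have h3 := stmtP_hasDerivAt α hx
  have h := h1.mul ((h2.comp x h3).mul (h3.pow (k + 1)))
  have e : x ^ (-(p + α + 1)) = x ^ (-p) * x ^ (-α - 1) := by
    rw [← Real.rpow_add hx]; congr 1; ring
  have e' : x ^ (-(p + 1)) = x ^ (-p - 1) := by congr 1; ring
  unfold stmtPhi
  rw [e, e']
  refine HasDerivAt.congr_deriv h ?_
  simp only [Pi.mul_apply, Pi.pow_apply, Function.comp_apply, Nat.add_sub_cancel]
  push_cast
  ring

lemma stmtPhi_bound {α : ℝ} (hα : 0 < α) {U : Set ℝ} (hUo : IsOpen U)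
    {f : ℝ → ℝ} {A B : ℝ} (hA : 0 < A) (hB : 0 < B)
    (hf' : IsWeaklyMild U (deriv f) A B 0) (n : ℕ) :
    ∀ (k : ℕ) (p : ℝ), 0 ≤ p → ∀ x ∈ Ioo (0:ℝ) 1, stmtP α x ∈ U →
      |iteratedDeriv n (stmtPhi α f k p) x| ≤
        B * (1 + α * A + α) ^ n * A ^ k * (k.factorial : ℝ) * stmtQ α n (k + 1 + p) *
          (stmtP α x * x ^ (-(p + (α + 1) * n))) := by
  induction n with
  | zero =>
    intro k p hp x hx hxU
    have hP : 0 < stmtP α x := Real.exp_pos _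
    have h := hf'.2 _ hxU k
    rw [zero_add, Real.rpow_one] at h
    have hxp : 0 < x ^ (-p) := Real.rpow_pos_of_pos hx.1 _
    simp only [iteratedDeriv_zero, stmtPhi, stmtQ, abs_mul, abs_of_pos hxp,
      abs_of_pos (pow_pos hP (k + 1))]
    calc _ ≤ x ^ (-p) * (B * A ^ k * (k.factorial : ℝ) / stmtP α x ^ k * stmtP α x ^ (k + 1)) := by
          gcongr
      _ = _ := by
          simp only [Nat.cast_zero, mul_zero, add_zero]
          field_simp
          ring
  | succ n ih =>
    intro k p hp x hx hxU
    have hP : 0 < stmtP α x := Real.exp_pos _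
    have hev : deriv (stmtPhi α f k p) =ᶠ[nhds x]
        ((fun t => (-p) * stmtPhi α f k (p + 1) t) +
        ((fun t => α * stmtPhi α f (k + 1) (p + α + 1) t)
        + (fun t => (α * (k + 1)) * stmtPhi α f k (p + α + 1) t))) := by
      have c := (stmtP_contDiffAt α hx.1).continuousAt
      filter_upwards [lt_mem_nhds hx.1, c.preimage_mem_nhds (hUo.mem_nhds hxU)] with t ht htU
      exact (stmtPhi_hasDerivAt α hUo hf'.1 k p ht htU).deriv
    have hs : ∀ k p, ContDiffAt ℝ n (stmtPhi α f k p) x := fun k p =>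
      (stmtPhi_contDiffAt α hUo hf'.1 k p hx.1 hxU).of_le (by exact_mod_cast le_top)
    rw [iteratedDeriv_succ', hev.iteratedDeriv_eq n]
    have hc : ∀ (c : ℝ) k p, ContDiffAt ℝ n (fun t => c * stmtPhi α f k p t) x := fun c k p =>
      contDiffAt_const.mul (hs k p)
    have hc2 : ContDiffAt ℝ n ((fun t => α * stmtPhi α f (k + 1) (p + α + 1) t)
        + (fun t => (α * (k + 1)) * stmtPhi α f k (p + α + 1) t)) x :=
      (hc _ _ _).add (hc _ _ _)
    rw [iteratedDeriv_add (hc _ _ _) hc2, iteratedDeriv_add (hc _ _ _) (hc _ _ _),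
      iteratedDeriv_const_mul_field, iteratedDeriv_const_mul_field, iteratedDeriv_const_mul_field]
    have i1 := ih k (p + 1) (by linarith) x hx hxU
    have i2 := ih (k + 1) (p + α + 1) (by linarith) x hx hxU
    have i3 := ih k (p + α + 1) (by linarith) x hx hxU
    set K := 1 + α * A + α with hK
    have hKpos : 0 < K := by positivity
    set a : ℝ := k + 1 + p with ha
    have hapos : 0 < a := by positivity
    set q := stmtQ α n (a + (α + 2)) with hq
    have hq0 : 0 ≤ q := stmtQ_nonneg hα n _ (by linarith)
    set X := x ^ (-(p + (α + 1) * ((n + 1 : ℕ) : ℝ))) with hX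
    have hX0 : 0 < X := Real.rpow_pos_of_pos hx.1 _
    have x1 : x ^ (-(p + 1 + (α + 1) * (n : ℝ))) ≤ X := by
      apply Real.rpow_le_rpow_of_exponent_ge hx.1 hx.2.le
      push_cast; nlinarith
    have x2 : x ^ (-(p + α + 1 + (α + 1) * (n : ℝ))) = X := by
      rw [hX]; congr 1; push_cast; ring
    have q1 : stmtQ α n (k + 1 + (p + 1)) ≤ q :=
      stmtQ_mono hα n _ _ (by positivity) (by rw [ha]; linarith)
    have q3 : stmtQ α n (k + 1 + (p + α + 1)) ≤ q :=
      stmtQ_mono hα n _ _ (by positivity) (by rw [ha]; linarith)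
    have q2 : stmtQ α n (((k + 1 : ℕ) : ℝ) + 1 + (p + α + 1)) = q := by
      rw [hq]; congr 1; rw [ha]; push_cast; ring
    rw [x2, q2] at i2
    rw [x2] at i3
    set W := B * K ^ n * A ^ k * (k.factorial : ℝ) * q * (stmtP α x * X) with hW
    have hW0 : 0 ≤ W := by positivity
    have j1 : |iteratedDeriv n (stmtPhi α f k (p + 1)) x| ≤ W := by
      refine i1.trans ?_
      have hx0 := (Real.rpow_pos_of_pos hx.1 (-(p + 1 + (α + 1) * (n : ℝ)))).le
      have hm := mul_nonneg hP.le hx0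
      rw [hW]
      gcongr
    have j3 : |iteratedDeriv n (stmtPhi α f k (p + α + 1)) x| ≤ W := by
      refine i3.trans ?_
      rw [hW]
      gcongr
    have j2 : |iteratedDeriv n (stmtPhi α f (k + 1) (p + α + 1)) x| ≤ A * (k + 1) * W := by
      refine i2.trans (le_of_eq ?_)
      rw [hW, Nat.factorial_succ]
      push_cast; ring
    have tot : B * K ^ (n + 1) * A ^ k * (k.factorial : ℝ) * stmtQ α (n + 1) a * (stmtP α x * X)
        = K * a * W := by
      rw [hW]; simp only [stmtQ]; ring
    rw [tot]
    refine (abs_add_le _ _).trans ((add_le_add_right (abs_add_le _ _) _).trans ?_)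
    rw [abs_mul, abs_mul, abs_mul, abs_neg, abs_of_nonneg hp, abs_of_pos hα,
      abs_of_nonneg (by positivity : 0 ≤ α * ((k : ℝ) + 1))]
    calc _ ≤ p * W + (α * (A * (k + 1) * W) + α * (k + 1) * W) := by gcongr
      _ = (p + α * A * (k + 1) + α * (k + 1)) * W := by ring
      _ ≤ K * a * W := by
        apply mul_le_mul_of_nonneg_right _ hW0
        have : 0 ≤ α * A * p := by positivity
        have : 0 ≤ α * p := by positivity
        have : (0:ℝ) ≤ k := by positivity
        rw [hK, ha]
        nlinarith

lemma stmt_exp_bound {α : ℝ} (hα : 0 < α) {x : ℝ} (hx : 0 < x) (m : ℕ) :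
    stmtP α x * x ^ (-((α + 1) * m)) ≤
      exp 1 * ((1 + 1 / α) ^ (1 + 1 / α)) ^ m * (m.factorial : ℝ) ^ (1 + 1 / α) := by
  set b := 1 + 1 / α with hb
  have hb0 : 0 < b := by positivity
  set s := x ^ (-α) with hs
  have hs0 : 0 < s := Real.rpow_pos_of_pos hx _
  have h1 : x ^ (-((α + 1) * m)) = (s ^ m) ^ b := by
    rw [hs, ← Real.rpow_natCast, ← Real.rpow_mul hx.le, ← Real.rpow_mul hx.le]
    congr 1
    rw [hb]; field_simp
  have h2 : stmtP α x = exp 1 * (exp (-(s / b))) ^ b := by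
    rw [← Real.exp_mul, ← Real.exp_add]
    unfold stmtP
    congr 1
    rw [← hs]; field_simp; ring
  have h3 : exp (-(s / b)) * s ^ m ≤ b ^ m * (m.factorial : ℝ) := by
    have := Real.pow_div_factorial_le_exp (s / b) (by positivity) m
    rw [Real.exp_neg, inv_mul_le_iff₀ (Real.exp_pos _)]
    rw [div_pow, div_div, div_le_iff₀ (by positivity)] at this
    exact this
  have h4 : (b ^ b) ^ m = (b ^ m) ^ b := by
    rw [← Real.rpow_natCast, ← Real.rpow_natCast, ← Real.rpow_mul hb0.le, ← Real.rpow_mul hb0.le,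
      mul_comm]
  rw [h1, h2, h4, mul_assoc, mul_assoc, ← Real.mul_rpow (by positivity) (by positivity),
    ← Real.mul_rpow (by positivity) (by positivity)]
  gcongr

theorem stmt16 (α : ℝ) (hα : 0 < α) (U : Set ℝ) (hUo : IsOpen U) (hU : U ⊆ Ioo 0 1)
    (f : ℝ → ℝ) (A B : ℝ) (hA : 0 < A) (hB : 0 < B)
    (hf : IsWeaklyMild U f A B 0) (hf' : IsWeaklyMild U (deriv f) A B 0) :
    ∃ A' B' : ℝ, 0 < A' ∧ 0 < B' ∧
      ∀ x ∈ Ioo (0:ℝ) 1 ∩ (fun t : ℝ => exp (1 - t ^ (-α))) ⁻¹' U, ∀ n : ℕ,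
        |iteratedDeriv n (f ∘ fun t : ℝ => exp (1 - t ^ (-α))) x| ≤
          B' * A' ^ n * (n.factorial : ℝ) ^ ((1 + 1 / α) + 1) := by
  set b := 1 + 1 / α with hb
  have hb0 : 0 < b := by positivity
  set K := 1 + α * A + α with hK
  have hK1 : 1 ≤ K := by rw [hK]; nlinarith [mul_pos hα hA]
  have hbb : 0 < b ^ b := Real.rpow_pos_of_pos hb0 _
  refine ⟨K * (α + 2) * b ^ b, B * (1 + α * exp 1), by positivity, by positivity, ?_⟩
  rintro x ⟨hx, hxU⟩ n
  change |iteratedDeriv n (f ∘ stmtP α) x| ≤ _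
  have hxU' : stmtP α x ∈ U := hxU
  rcases n with _ | n
  · have h := hf.2 _ hxU' 0
    simp only [iteratedDeriv_zero, pow_zero, Nat.factorial_zero, Nat.cast_one, Real.one_rpow,
      mul_one, div_one] at h ⊢
    refine h.trans ?_
    have : 0 ≤ B * (α * exp 1) := by positivity
    linarith
  · have hev : deriv (f ∘ stmtP α) =ᶠ[nhds x] fun t => α * stmtPhi α f 0 (α + 1) t := by
      have c := (stmtP_contDiffAt α hx.1).continuousAt
      filter_upwards [lt_mem_nhds hx.1, c.preimage_mem_nhds (hUo.mem_nhds hxU')] with t ht htU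
      have h2 : HasDerivAt f (deriv f (stmtP α t)) (stmtP α t) :=
        ((hf.1.contDiffAt (hUo.mem_nhds htU)).differentiableAt (by simp)).hasDerivAt
      rw [(h2.comp t (stmtP_hasDerivAt α ht)).deriv]
      simp only [stmtPhi, iteratedDeriv_zero]
      rw [show -(α + 1) = -α - 1 by ring]
      ring
    rw [iteratedDeriv_succ', hev.iteratedDeriv_eq n, iteratedDeriv_const_mul_field, abs_mul,
      abs_of_pos hα]
    have h := stmtPhi_bound hα hUo hA hB hf' n 0 (α + 1) (by linarith) x hx hxU'
    have hq := stmtQ_eval α n 0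
    simp only [Nat.cast_zero, zero_add, Nat.factorial_zero, Nat.cast_one, mul_one, one_mul,
      add_zero, pow_zero] at hq h
    rw [show (1 : ℝ) + (α + 1) = α + 2 by ring, hq,
      show α + 1 + (α + 1) * (n : ℝ) = (α + 1) * ((n + 1 : ℕ) : ℝ) by push_cast; ring] at h
    have he := stmt_exp_bound hα hx.1 (n + 1)
    rw [← hb] at he
    have hfac : (n.factorial : ℝ) ≤ ((n + 1).factorial : ℝ) := by
      exact_mod_cast Nat.factorial_le (Nat.le_succ n)
    have hF : (0:ℝ) < ((n + 1).factorial : ℝ) := by positivity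
    rw [Real.rpow_add hF, Real.rpow_one]
    set F := ((n + 1).factorial : ℝ)
    have hKn : K ^ n ≤ K ^ (n + 1) := pow_le_pow_right₀ hK1 (Nat.le_succ n)
    have han : (α + 2) ^ n ≤ (α + 2) ^ (n + 1) :=
      pow_le_pow_right₀ (by linarith) (Nat.le_succ n)
    calc _ ≤ α * (B * K ^ n * ((α + 2) ^ n * (n.factorial : ℝ)) *
            (exp 1 * (b ^ b) ^ (n + 1) * F ^ b)) := by
          gcongr
          refine h.trans ?_
          gcongr
      _ ≤ α * (B * K ^ (n + 1) * ((α + 2) ^ (n + 1) * F) *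
            (exp 1 * (b ^ b) ^ (n + 1) * F ^ b)) := by
          gcongr
      _ = B * (α * exp 1) * (K * (α + 2) * b ^ b) ^ (n + 1) * (F ^ b * F) := by
          rw [mul_pow, mul_pow]; ring
      _ ≤ _ := by
          gcongr
          linarith
end

section
/- Let α ≥ 1, let U ⊆ (0,1)^m be open, let μ ∈ ℝ^m, and let b(x) = x^μ = x_1^{μ_1}⋯x_m^{μ_m} be a bounded-monomial function on U (i.e., b is bounded on U) whose first-order partial derivatives ∂b/∂x_i are all bounded on U. Let P : (0,1)^m → (0,1)^m be given by P(x_1,…,x_m) = (P_α(x_1),…,P_α(x_m)) where P_α(x) = exp(1 - x^{-α}), and let N = max_{1 ≤ i ≤ m} |μ_i|. Then there exists B > 0 such that b ∘ P : P^{-1}(U) → ℝ is (2α(2mN+1), B, 1/α)-mild; that is, for every x ∈ P^{-1}(U) and every multi-index ν ∈ ℕ^m, |(b ∘ P)^{(ν)}(x)| ≤ B · (2α(2mN+1))^{|ν|} · (|ν|!)^{1/α + 1}. -/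
open Real Set

lemma pDeriv_prod {m : ℕ} (φ : Fin m → ℝ → ℝ) (f : (Fin m → ℝ) → ℝ) (x : Fin m → ℝ)
    (φ' : Fin m → ℝ) (h : ∀ k, HasDerivAt (φ k) (φ' k) (x k))
    (hf : f =ᶠ[nhds x] fun y => ∏ k, φ k (y k)) (i : Fin m) :
    pDeriv i f x = φ' i * ∏ k ∈ Finset.univ.erase i, φ k (x k) := by
  unfold pDeriv
  rw [hf.fderiv_eq]
  have hd : DifferentiableAt ℝ (fun y : Fin m → ℝ => ∏ k, φ k (y k)) x := by
    refine (HasFDerivAt.finsetProd (u := Finset.univ) (g := fun k (y : Fin m → ℝ) => φ k (y k))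
      (fun k _ => DifferentiableAt.hasFDerivAt ?_)).differentiableAt
    exact DifferentiableAt.comp (g := φ k) x (h k).differentiableAt (differentiableAt_apply k x)
  have h1 := hasDerivAt_update (𝕜 := ℝ) x i (x i)
  have hd' : HasFDerivAt (fun y : Fin m → ℝ => ∏ k, φ k (y k)) (fderiv ℝ (fun y : Fin m → ℝ => ∏ k, φ k (y k)) x) (Function.update x i (x i)) := by
    rw [Function.update_eq_self]; exact hd.hasFDerivAt
  have h2 := hd'.comp_hasDerivAt (x i) h1
  have h3 : HasDerivAt (fun t => φ i t * ∏ k ∈ Finset.univ.erase i, φ k (x k))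
      (φ' i * ∏ k ∈ Finset.univ.erase i, φ k (x k)) (x i) := (h i).mul_const _
  have h4 : ((fun y : Fin m → ℝ => ∏ k, φ k (y k)) ∘ Function.update x i) =
      (fun t => φ i t * ∏ k ∈ Finset.univ.erase i, φ k (x k)) := by
    funext t
    simp only [Function.comp]
    rw [← Finset.mul_prod_erase _ _ (Finset.mem_univ i)]
    congr 1
    · simp
    · apply Finset.prod_congr rfl
      intro k hk
      rw [Function.update_of_ne (Finset.ne_of_mem_erase hk)]
  rw [h4] at h2
  exact h2.unique h3

lemma posSet_open {m : ℕ} : IsOpen {x : Fin m → ℝ | ∀ i, 0 < x i} := by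
  have : {x : Fin m → ℝ | ∀ i, 0 < x i} = Set.pi univ (fun _ => Ioi 0) := by
    ext; simp
  rw [this]
  exact isOpen_set_pi finite_univ (fun _ _ => isOpen_Ioi)

lemma pDeriv_step {m : ℕ} (ψ : Fin m → ℕ → ℝ → ℝ)
    (hψ : ∀ k n t, 0 < t → HasDerivAt (ψ k n) (ψ k (n+1) t) t)
    (f : (Fin m → ℝ) → ℝ) (n : Fin m → ℕ)
    (hf : ∀ x : Fin m → ℝ, (∀ i, 0 < x i) → f x = ∏ k, ψ k (n k) (x k)) (i : Fin m) :
    ∀ x : Fin m → ℝ, (∀ i, 0 < x i) →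
      pDeriv i f x = ∏ k, ψ k ((n + (Pi.single i 1 : Fin m → ℕ)) k) (x k) := by
  intro x hx
  have he : f =ᶠ[nhds x] fun y => ∏ k, ψ k (n k) (y k) := by
    filter_upwards [posSet_open.mem_nhds hx] with y hy using hf y hy
  rw [pDeriv_prod (fun k => ψ k (n k)) f x (fun k => ψ k (n k + 1) (x k))
    (fun k => hψ k _ _ (hx k)) he i, ← Finset.mul_prod_erase _ _ (Finset.mem_univ i)]
  congr 1
  · simp
  · apply Finset.prod_congr rfl
    intro k hk
    simp [Pi.single_eq_of_ne (Finset.ne_of_mem_erase hk)]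

lemma pDeriv_iter {m : ℕ} (ψ : Fin m → ℕ → ℝ → ℝ)
    (hψ : ∀ k n t, 0 < t → HasDerivAt (ψ k n) (ψ k (n+1) t) t)
    (f : (Fin m → ℝ) → ℝ) (n : Fin m → ℕ)
    (hf : ∀ x : Fin m → ℝ, (∀ i, 0 < x i) → f x = ∏ k, ψ k (n k) (x k)) (i : Fin m) (j : ℕ) :
    ∀ x : Fin m → ℝ, (∀ i, 0 < x i) →
      (pDeriv i)^[j] f x = ∏ k, ψ k ((n + (Pi.single i j : Fin m → ℕ)) k) (x k) := by
  induction j with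
  | zero => simpa using hf
  | succ j ih =>
    intro x hx
    rw [Function.iterate_succ_apply']
    rw [pDeriv_step ψ hψ _ _ ih i x hx, add_assoc, ← Pi.single_add]

lemma mDeriv_prod {m : ℕ} (ψ : Fin m → ℕ → ℝ → ℝ)
    (hψ : ∀ k n t, 0 < t → HasDerivAt (ψ k n) (ψ k (n+1) t) t)
    (f : (Fin m → ℝ) → ℝ)
    (hf : ∀ x : Fin m → ℝ, (∀ i, 0 < x i) → f x = ∏ k, ψ k 0 (x k)) (ν : Fin m → ℕ) :
    ∀ x : Fin m → ℝ, (∀ i, 0 < x i) → mDeriv ν f x = ∏ k, ψ k (ν k) (x k) := by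
  have key : ∀ l : List (Fin m), ∀ x : Fin m → ℝ, (∀ i, 0 < x i) →
      l.foldr (fun i g => (pDeriv i)^[ν i] g) f x =
        ∏ k, ψ k ((l.map (fun i => (Pi.single i (ν i) : Fin m → ℕ))).sum k) (x k) := by
    intro l
    induction l with
    | nil => simpa using hf
    | cons a l ih =>
      intro x hx
      rw [List.foldr_cons, pDeriv_iter ψ hψ _ _ ih a (ν a) x hx, List.map_cons, List.sum_cons,
        add_comm]
  intro x hx
  unfold mDeriv
  rw [key _ x hx, ← Fin.sum_univ_def, Finset.univ_sum_single]

/-- complexification -/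
noncomputable def cF (μ α : ℝ) (z : ℂ) : ℂ := Complex.exp ((1 - z ^ ((-α : ℝ) : ℂ)) * μ)

noncomputable def psi (μ α : ℝ) (n : ℕ) (t : ℝ) : ℝ := (iteratedDeriv n (cF μ α) (t : ℂ)).re

lemma cF_diff (μ α : ℝ) : DifferentiableOn ℂ (cF μ α) Complex.slitPlane := by
  intro z hz
  apply DifferentiableAt.differentiableWithinAt
  unfold cF
  have : DifferentiableAt ℂ (fun z : ℂ => z ^ ((-α : ℝ) : ℂ)) z :=
    differentiableAt_id.cpow_const hz
  exact ((this.const_sub 1).mul_const _).cexp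

lemma cF_iter_diff (μ α : ℝ) (n : ℕ) :
    DifferentiableOn ℂ (iteratedDeriv n (cF μ α)) Complex.slitPlane := by
  induction n with
  | zero => simpa using cF_diff μ α
  | succ n ih =>
    rw [iteratedDeriv_succ]
    exact ih.deriv Complex.isOpen_slitPlane

lemma psi_deriv (μ α : ℝ) (n : ℕ) (t : ℝ) (ht : 0 < t) :
    HasDerivAt (psi μ α n) (psi μ α (n+1) t) t := by
  unfold psi
  apply HasDerivAt.real_of_complex
  rw [iteratedDeriv_succ]
  apply DifferentiableAt.hasDerivAt
  apply (cF_iter_diff μ α n).differentiableAt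
  exact Complex.isOpen_slitPlane.mem_nhds (Complex.ofReal_mem_slitPlane.2 ht)

lemma psi_zero (μ α t : ℝ) (ht : 0 < t) : psi μ α 0 t = exp ((1 - t ^ (-α)) * μ) := by
  unfold psi cF
  simp only [iteratedDeriv_zero]
  rw [← Complex.ofReal_cpow ht.le, ← Complex.ofReal_one, ← Complex.ofReal_sub,
    ← Complex.ofReal_mul, ← Complex.ofReal_exp, Complex.ofReal_re]

lemma psi_const (α t : ℝ) (n : ℕ) (hn : n ≠ 0) : psi 0 α n t = 0 := by
  have : cF 0 α = fun _ => 1 := by funext z; simp [cF]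
  unfold psi
  rw [this, iteratedDeriv_const]
  simp [hn]

lemma cpow_sub_bound (α t r : ℝ) (hα : 0 < α) (hr : 0 < r) (hrt : r < t) (z : ℂ)
    (hz : ‖z - t‖ ≤ r) :
    ‖z ^ ((-α : ℝ) : ℂ) - ((t ^ (-α) : ℝ) : ℂ)‖ ≤ (t - r) ^ (-α) - t ^ (-α) := by
  have ht : 0 < t := hr.trans hrt
  have hre : ∀ s ∈ Icc (0:ℝ) 1, t - s * r ≤ ((t : ℂ) + s * (z - t)).re := by
    intro s hs
    have h1 : -r ≤ (z - t).re := by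
      have := (abs_le.1 ((Complex.abs_re_le_norm (z - t)).trans hz)).1
      exact this
    have : ((t : ℂ) + s * (z - t)).re = t + s * (z - t).re := by simp
    rw [this]
    nlinarith [hs.1]
  have hpos : ∀ s ∈ Icc (0:ℝ) 1, 0 < t - s * r := by
    intro s hs
    nlinarith [hs.1, hs.2]
  have hD : ∀ s ∈ Icc (0:ℝ) 1, HasDerivAt
      (fun s : ℝ => ((t : ℂ) + s * (z - t)) ^ ((-α : ℝ) : ℂ) - ((t ^ (-α) : ℝ) : ℂ))
      (((-α : ℝ) : ℂ) * ((t : ℂ) + s * (z - t)) ^ (((-α : ℝ) : ℂ) - 1) * (z - t)) s := by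
    intro s hs
    have h0 : HasDerivAt (fun s : ℂ => (t : ℂ) + s * (z - t)) (z - t) (s : ℂ) := by
      simpa using ((hasDerivAt_id (s : ℂ)).mul_const (z - t)).const_add (t : ℂ)
    have hs' : (t : ℂ) + s * (z - t) ∈ Complex.slitPlane := by
      left; exact (hpos s hs).trans_le (hre s hs)
    exact ((h0.cpow_const hs').sub_const _).comp_ofReal
  have hB : ∀ s ∈ Icc (0:ℝ) 1, HasDerivAt
      (fun s : ℝ => (t - s * r) ^ (-α) - t ^ (-α))
      (α * (t - s * r) ^ (-α - 1) * r) s := by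
    intro s hs
    have h0 : HasDerivAt (fun s : ℝ => t - s * r) (-r) s := by
      simpa using ((hasDerivAt_id s).mul_const r).const_sub t
    have := (h0.rpow_const (p := -α) (Or.inl (hpos s hs).ne')).sub_const (t ^ (-α))
    have e : α * (t - s * r) ^ (-α - 1) * r = -r * -α * (t - s * r) ^ (-α - 1) := by ring
    rw [e]
    exact this
  have := image_norm_le_of_norm_deriv_right_le_deriv_boundary' (a := 0) (b := 1)
    (fun s hs => (hD s hs).continuousAt.continuousWithinAt)
    (fun s hs => (hD s ⟨hs.1, hs.2.le⟩).hasDerivWithinAt)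
    (B := fun s : ℝ => (t - s * r) ^ (-α) - t ^ (-α))
    (B' := fun s : ℝ => α * (t - s * r) ^ (-α - 1) * r)
    (by simp [Complex.ofReal_cpow ht.le])
    (fun s hs => (hB s hs).continuousAt.continuousWithinAt)
    (fun s hs => (hB s ⟨hs.1, hs.2.le⟩).hasDerivWithinAt)
    (by
      intro s hs
      have hs' : s ∈ Icc (0:ℝ) 1 := ⟨hs.1, hs.2.le⟩
      have e : ((-α : ℝ) : ℂ) - 1 = ((-α - 1 : ℝ) : ℂ) := by push_cast; ring
      rw [norm_mul, norm_mul, e, Complex.norm_cpow_real, Complex.norm_real, norm_neg,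
        Real.norm_of_nonneg hα.le]
      have h1 : ‖(t : ℂ) + s * (z - t)‖ ^ (-α - 1) ≤ (t - s * r) ^ (-α - 1) := by
        apply Real.rpow_le_rpow_of_nonpos (hpos s hs')
        · exact (hre s hs').trans (Complex.re_le_norm _)
        · linarith
      have h0 := Real.rpow_nonneg (hpos s hs').le (-α - 1)
      exact mul_le_mul (mul_le_mul_of_nonneg_left h1 hα.le) hz (norm_nonneg _) (mul_nonneg hα.le h0))
    (right_mem_Icc.2 zero_le_one)
  simpa using this

lemma psi_bound (μ α ρ δ : ℝ) (hα : 0 < α) (hρ : 0 < ρ) (hρ1 : ρ < 1)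
    (hδ : (1 - ρ) ^ (-α) - 1 ≤ δ) (t : ℝ) (ht : 0 < t) (n : ℕ) :
    |psi μ α n t| ≤ exp ((1 - t ^ (-α)) * μ) * exp (|μ| * t ^ (-α) * δ) * n.factorial
      * ρ⁻¹ ^ n * t⁻¹ ^ n := by
  have hr : 0 < ρ * t := by positivity
  have hrt : ρ * t < t := by nlinarith
  have hsub : ∀ z : ℂ, ‖z - t‖ ≤ ρ * t → z ∈ Complex.slitPlane := by
    intro z hz
    left
    have := (abs_le.1 ((Complex.abs_re_le_norm (z - t)).trans hz)).1
    simp at this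
    linarith
  have hcont : DiffContOnCl ℂ (cF μ α) (Metric.ball (t : ℂ) (ρ * t)) := by
    apply DifferentiableOn.diffContOnCl
    apply (cF_diff μ α).mono
    intro z hz
    apply hsub
    have := Metric.closure_ball_subset_closedBall hz
    rwa [Metric.mem_closedBall, dist_eq_norm] at this
  have := Complex.norm_iteratedDeriv_le_of_forall_mem_sphere_norm_le n hr hcont
    (C := exp ((1 - t ^ (-α)) * μ) * exp (|μ| * t ^ (-α) * δ)) (by
      intro z hz
      rw [mem_sphere_iff_norm] at hz
      have h1 := cpow_sub_bound α t (ρ * t) hα hr hrt z hz.le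
      have h2 : (t - ρ * t) ^ (-α) = t ^ (-α) * (1 - ρ) ^ (-α) := by
        rw [← Real.mul_rpow ht.le (by linarith)]; congr 1; ring
      rw [h2] at h1
      have htp : 0 < t ^ (-α) := Real.rpow_pos_of_pos ht _
      have h3 : ‖z ^ ((-α : ℝ) : ℂ) - ((t ^ (-α) : ℝ) : ℂ)‖ ≤ t ^ (-α) * δ := by nlinarith
      unfold cF
      rw [Complex.norm_exp, ← Real.exp_add]
      apply Real.exp_le_exp.2
      rw [Complex.re_mul_ofReal]
      have h4 := (abs_le.1 (Complex.abs_re_le_norm (z ^ ((-α : ℝ) : ℂ) - ((t ^ (-α) : ℝ) : ℂ))))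
      rw [Complex.sub_re, Complex.ofReal_re] at h4
      rw [Complex.sub_re, Complex.one_re]
      have h5 : |(z ^ ((-α : ℝ) : ℂ)).re - t ^ (-α)| ≤ t ^ (-α) * δ := (abs_le.2 h4).trans h3
      have h6 : -(((z ^ ((-α : ℝ) : ℂ)).re - t ^ (-α)) * μ) ≤ |μ| * (t ^ (-α) * δ) := by
        refine (neg_le_abs _).trans ?_
        rw [abs_mul, mul_comm]
        gcongr
      linarith)
  unfold psi
  refine (Complex.abs_re_le_norm _).trans (this.trans (le_of_eq ?_))
  rw [mul_pow, div_eq_mul_inv, mul_inv, inv_pow, inv_pow]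
  ring

lemma growth (α v : ℝ) (hα : 1 ≤ α) (hv : 0 < v) (n : ℕ) :
    v ^ n * exp (-(v ^ α) / 2) ≤ 2 ^ n * (n.factorial : ℝ) ^ (1 / α) := by
  have hα0 : 0 < α := by linarith
  have hf : (0:ℝ) < n.factorial := by exact_mod_cast n.factorial_pos
  rw [← Real.rpow_le_rpow_iff (z := α) (by positivity) (by positivity) hα0]
  rw [Real.mul_rpow (by positivity) (by positivity), Real.mul_rpow (by positivity) (by positivity),
    ← Real.rpow_mul hf.le, one_div_mul_cancel hα0.ne', Real.rpow_one, ← Real.exp_mul]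
  have e : (v ^ n) ^ α = (v ^ α) ^ n := by
    rw [← Real.rpow_natCast, ← Real.rpow_natCast, ← Real.rpow_mul hv.le, ← Real.rpow_mul hv.le,
      mul_comm]
  rw [e]
  set u := v ^ α with hu
  have hu0 : 0 < u := by positivity
  have h1 := Real.pow_div_factorial_le_exp (u / 2) (by positivity) n
  have h2 : exp (u / 2) ≤ exp (u / 2 * α) := by
    apply Real.exp_le_exp.2; nlinarith
  have h3 : (2:ℝ) ^ n ≤ ((2:ℝ) ^ n) ^ α := Real.self_le_rpow_of_one_le (one_le_pow₀ (by norm_num)) hα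
  have h4 : u ^ n ≤ 2 ^ n * n.factorial * exp (u / 2 * α) := by
    have := h1.trans h2
    rw [div_le_iff₀ hf, div_pow, div_le_iff₀ (by positivity)] at this
    linarith
  have h5 : exp (u / 2 * α) * exp (-u / 2 * α) = 1 := by
    rw [← Real.exp_add, ← Real.exp_zero]; congr 1; ring
  calc u ^ n * exp (-u / 2 * α) ≤ 2 ^ n * n.factorial * exp (u / 2 * α) * exp (-u / 2 * α) := by
        gcongr
    _ = 2 ^ n * n.factorial := by rw [mul_assoc, h5, mul_one]
    _ ≤ _ := by gcongr

lemma rho_bound (α K : ℝ) (hα : 1 ≤ α) (hK : 0 < K) :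
    (1 - (α * (K + 1))⁻¹) ^ (-α) - 1 ≤ K⁻¹ := by
  have hα0 : 0 < α := by linarith
  have hρ : (α * (K + 1))⁻¹ < 1 := inv_lt_one_of_one_lt₀ (by nlinarith)
  have h := one_add_mul_self_le_rpow_one_add (s := -(α * (K + 1))⁻¹) (by linarith) hα
  have e : 1 + α * -(α * (K + 1))⁻¹ = K / (K + 1) := by field_simp; ring
  rw [e, ← sub_eq_add_neg] at h
  rw [Real.rpow_neg (by linarith)]
  have : ((1 - (α * (K + 1))⁻¹) ^ α)⁻¹ ≤ (K / (K + 1))⁻¹ := inv_anti₀ (by positivity) h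
  have e2 : (K / (K + 1))⁻¹ = 1 + K⁻¹ := by field_simp
  linarith

lemma deriv_bound {m : ℕ} (hm : 0 < m) (α : ℝ) (hα : 1 ≤ α) (μ : Fin m → ℝ) (N : ℝ)
    (hN : ∀ i, |μ i| ≤ N) (C : ℝ) (hC : 0 < C) (x : Fin m → ℝ) (hx : ∀ i, 0 < x i)
    (h0 : ∏ k, exp ((1 - x k ^ (-α)) * μ k) ≤ C)
    (h1 : ∀ j, μ j ≠ 0 → ∏ k, exp ((1 - x k ^ (-α)) * μ k) ≤ C * exp (1 - x j ^ (-α)))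
    (ν : Fin m → ℕ) :
    |∏ k, psi (μ k) α (ν k) (x k)| ≤ (C * exp 1) * (2 * α * (2 * m * N + 1)) ^ (∑ i, ν i) *
      ((∑ i, ν i).factorial : ℝ) ^ (1 / α + 1) := by
  have hα0 : 0 < α := by linarith
  have hN0 : 0 ≤ N := (abs_nonneg _).trans (hN ⟨0, hm⟩)
  have hm' : (0:ℝ) < m := by exact_mod_cast hm
  have he : 1 ≤ exp 1 := Real.one_le_exp zero_le_one
  by_cases hz : ∃ j, μ j = 0 ∧ ν j ≠ 0
  · obtain ⟨j, hj, hj'⟩ := hz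
    have : ∏ k, psi (μ k) α (ν k) (x k) = 0 := by
      apply Finset.prod_eq_zero (Finset.mem_univ j)
      rw [hj, psi_const _ _ _ hj']
    rw [this, abs_zero]
    positivity
  push Not at hz
  by_cases hS : ∀ j, μ j = 0
  · have hν : ∀ j, ν j = 0 := fun j => hz j (hS j)
    have : ∏ k, psi (μ k) α (ν k) (x k) = ∏ k, exp ((1 - x k ^ (-α)) * μ k) := by
      apply Finset.prod_congr rfl
      intro k _
      rw [hν k, psi_zero _ _ _ (hx k)]
    rw [this, abs_of_pos (Finset.prod_pos fun _ _ => Real.exp_pos _)]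
    simp only [hν, Finset.sum_const_zero, pow_zero, Nat.factorial_zero, Nat.cast_one,
      Real.one_rpow, mul_one]
    nlinarith
  push Not at hS
  obtain ⟨j0, hj0⟩ := hS
  obtain ⟨j, hjS, hjmin⟩ := Finset.exists_min_image (Finset.univ.filter fun k => μ k ≠ 0) x
    ⟨j0, by simp [hj0]⟩
  have hμj : μ j ≠ 0 := by simpa using hjS
  have hmin : ∀ k, μ k ≠ 0 → x j ≤ x k := fun k hk => hjmin k (by simp [hk])
  have hNp : 0 < N := (abs_pos.2 hj0).trans_le (hN j0)
  set K := 2 * m * N with hK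
  have hKp : 0 < K := by positivity
  set ρ := (α * (K + 1))⁻¹ with hρ
  have hρp : 0 < ρ := by positivity
  have hρ1 : ρ < 1 := inv_lt_one_of_one_lt₀ (by nlinarith)
  have hδ := rho_bound α K hα hKp
  rw [← hρ] at hδ
  set n := ∑ i, ν i with hn
  set v := (x j)⁻¹ with hv
  have hvp : 0 < v := inv_pos.2 (hx j)
  have hu : x j ^ (-α) = v ^ α := by rw [hv, Real.inv_rpow (hx j).le, Real.rpow_neg (hx j).le]
  have hu0 : 0 < v ^ α := by positivity
  have A1 : ∏ k, exp (|μ k| * x k ^ (-α) * K⁻¹) ≤ exp (v ^ α / 2) := by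
    rw [← Real.exp_sum]
    apply Real.exp_le_exp.2
    calc ∑ k, |μ k| * x k ^ (-α) * K⁻¹ ≤ ∑ k : Fin m, N * v ^ α * K⁻¹ := by
          apply Finset.sum_le_sum
          intro k _
          by_cases hk : μ k = 0
          · rw [hk]; simp; positivity
          · have : x k ^ (-α) ≤ v ^ α := by
              rw [← hu]
              exact Real.rpow_le_rpow_of_nonpos (hx j) (hmin k hk) (by linarith)
            have h3 := Real.rpow_nonneg (hx k).le (-α)
            have := mul_le_mul (hN k) this h3 hN0
            exact mul_le_mul_of_nonneg_right this (by positivity)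
      _ = v ^ α / 2 := by
          rw [Finset.sum_const, Finset.card_univ, Fintype.card_fin, nsmul_eq_mul, hK]
          field_simp
  have A2 : ∏ k, (x k)⁻¹ ^ ν k ≤ v ^ n := by
    rw [hn, ← Finset.prod_pow_eq_pow_sum]
    apply Finset.prod_le_prod
    · intro k _; have := hx k; positivity
    · intro k _
      by_cases hk : μ k = 0
      · rw [hz k hk]; simp
      · have := hx k
        have := inv_anti₀ (hx j) (hmin k hk)
        gcongr
  have A3 : ∏ k, ((ν k).factorial : ℝ) ≤ n.factorial := by
    exact_mod_cast Nat.le_of_dvd n.factorial_pos (Nat.prod_factorial_dvd_factorial_sum _ _)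
  have A4 : ∏ k, ρ⁻¹ ^ ν k = ρ⁻¹ ^ n := by rw [hn, ← Finset.prod_pow_eq_pow_sum]
  have A5 := h1 j hμj
  have P1 : 0 ≤ ∏ k, exp ((1 - x k ^ (-α)) * μ k) := Finset.prod_nonneg fun _ _ => (Real.exp_pos _).le
  have P2 : 0 ≤ ∏ k, exp (|μ k| * x k ^ (-α) * K⁻¹) := Finset.prod_nonneg fun _ _ => (Real.exp_pos _).le
  have P3 : 0 ≤ ∏ k, (x k)⁻¹ ^ ν k := Finset.prod_nonneg fun k _ => by have := hx k; positivity
  have P4 : 0 ≤ ∏ k, ((ν k).factorial : ℝ) := by positivity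
  have hf : (0:ℝ) < n.factorial := by exact_mod_cast n.factorial_pos
  calc |∏ k, psi (μ k) α (ν k) (x k)| = ∏ k, |psi (μ k) α (ν k) (x k)| := Finset.abs_prod _ _
    _ ≤ ∏ k, (exp ((1 - x k ^ (-α)) * μ k) * exp (|μ k| * x k ^ (-α) * K⁻¹) * (ν k).factorial
      * ρ⁻¹ ^ ν k * (x k)⁻¹ ^ ν k) :=
        Finset.prod_le_prod (fun _ _ => abs_nonneg _)
          (fun k _ => psi_bound (μ k) α ρ K⁻¹ hα0 hρp hρ1 hδ (x k) (hx k) (ν k))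
    _ = (∏ k, exp ((1 - x k ^ (-α)) * μ k)) * (∏ k, exp (|μ k| * x k ^ (-α) * K⁻¹)) *
        (∏ k, ((ν k).factorial : ℝ)) * ρ⁻¹ ^ n * ∏ k, (x k)⁻¹ ^ ν k := by
        rw [Finset.prod_mul_distrib, Finset.prod_mul_distrib, Finset.prod_mul_distrib,
          Finset.prod_mul_distrib, A4]
    _ ≤ (C * exp (1 - x j ^ (-α))) * exp (v ^ α / 2) * n.factorial * ρ⁻¹ ^ n * v ^ n := by
        gcongr
    _ = (C * exp 1) * n.factorial * ρ⁻¹ ^ n * (v ^ n * exp (-(v ^ α) / 2)) := by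
        have : exp (1 - x j ^ (-α)) * exp (v ^ α / 2) = exp 1 * exp (-(v ^ α) / 2) := by
          rw [hu, ← Real.exp_add, ← Real.exp_add]; congr 1; ring
        calc _ = C * (exp (1 - x j ^ (-α)) * exp (v ^ α / 2)) * n.factorial * ρ⁻¹ ^ n * v ^ n := by
              ring
          _ = _ := by rw [this]; ring
    _ ≤ (C * exp 1) * n.factorial * ρ⁻¹ ^ n * (2 ^ n * (n.factorial : ℝ) ^ (1 / α)) := by
        have := growth α v hα hvp n
        gcongr
    _ = _ := by
        rw [Real.rpow_add hf, Real.rpow_one, hρ, inv_inv,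
          show 2 * α * (K + 1) = α * (K + 1) * 2 by ring, mul_pow _ (2:ℝ)]
        ring

theorem stmt17 {m : ℕ} (hm : 0 < m) (α : ℝ) (hα : 1 ≤ α)
    (U : Set (Fin m → ℝ)) (hUo : IsOpen U)
    (hU : U ⊆ univ.pi fun _ : Fin m => Ioo (0:ℝ) 1)
    (μ : Fin m → ℝ) (b : (Fin m → ℝ) → ℝ) (hb : ∀ x, b x = ∏ i, x i ^ μ i)
    (hbdd : ∃ M : ℝ, ∀ x ∈ U, |b x| ≤ M)
    (hpart : ∀ j : Fin m, ∃ M : ℝ, ∀ x ∈ U, |pDeriv j b x| ≤ M)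
    (P : (Fin m → ℝ) → Fin m → ℝ) (hP : ∀ x i, P x i = exp (1 - x i ^ (-α)))
    (N : ℝ) (hN : N = ⨆ i, |μ i|) :
    ∃ B : ℝ, 0 < B ∧
      IsMildM ((univ.pi fun _ : Fin m => Ioo (0:ℝ) 1) ∩ P ⁻¹' U) (b ∘ P)
        (2 * α * (2 * m * N + 1)) B (1 / α) := by
  have hN' : ∀ i, |μ i| ≤ N := by
    intro i
    rw [hN]
    exact le_ciSup (f := fun i => |μ i|) (finite_range _).bddAbove i
  have hbP : ∀ x, (b ∘ P) x = ∏ k, exp ((1 - x k ^ (-α)) * μ k) := by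
    intro x
    simp only [Function.comp, hb, hP, Real.exp_mul]
  obtain ⟨M0, hM0⟩ := hbdd
  choose M hM using hpart
  -- the key bound from boundedness of the partial derivatives
  have hkey : ∀ y ∈ U, ∀ j, μ j ≠ 0 → b y ≤ |M j| / |μ j| * y j := by
    intro y hy j hj
    have hypos : ∀ k, 0 < y k := fun k => (hU hy k (mem_univ k)).1
    have hd := pDeriv_prod (fun k t => t ^ μ k) b y (fun k => μ k * y k ^ (μ k - 1))
      (fun k => Real.hasDerivAt_rpow_const (Or.inl (hypos k).ne'))
      (Filter.Eventually.of_forall hb) j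
    have hby : y j * pDeriv j b y = μ j * b y := by
      rw [hd, hb, ← Finset.mul_prod_erase _ _ (Finset.mem_univ j), Real.rpow_sub_one (hypos j).ne']
      have := (hypos j).ne'
      field_simp
    have hbpos : 0 < b y := by
      rw [hb]; exact Finset.prod_pos fun k _ => Real.rpow_pos_of_pos (hypos k) _
    have h1 : |μ j| * b y = y j * |pDeriv j b y| := by
      rw [← abs_of_pos hbpos, ← abs_mul, ← hby, abs_mul, abs_of_pos (hypos j)]
    have h2 := (hM j y hy).trans (le_abs_self _)
    rw [div_mul_eq_mul_div, le_div_iff₀ (abs_pos.2 hj), mul_comm, h1, mul_comm]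
    exact mul_le_mul_of_nonneg_right h2 (hypos j).le
  set C := |M0| + ∑ j, |M j| / |μ j| + 1 with hC
  have hs : 0 ≤ ∑ j, |M j| / |μ j| := Finset.sum_nonneg fun _ _ => by positivity
  have hCp : 0 < C := by positivity
  refine ⟨C * exp 1, by positivity, ?_, ?_⟩
  · have : b ∘ P = fun x => ∏ k, exp ((1 - x k ^ (-α)) * μ k) := funext hbP
    rw [this]
    intro x hx
    apply ContDiffAt.contDiffWithinAt
    apply contDiffAt_prod
    intro k _
    have hxk : x k ≠ 0 := (hx.1 k (mem_univ k)).1.ne'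
    have h1 : ContDiffAt ℝ (⊤ : ℕ∞) (fun y : Fin m → ℝ => y k) x := (contDiff_apply ℝ ℝ k).contDiffAt
    have h2 := h1.rpow_const_of_ne (p := -α) hxk
    exact ((contDiffAt_const.sub h2).mul contDiffAt_const).exp
  · intro x hx ν
    have hxpos : ∀ k, 0 < x k := fun k => (hx.1 k (mem_univ k)).1
    rw [mDeriv_prod (fun k => psi (μ k) α) (fun k n t ht => psi_deriv _ _ _ _ ht) (b ∘ P) (by
      intro y hy
      rw [hbP]
      exact Finset.prod_congr rfl fun k _ => (psi_zero _ _ _ (hy k)).symm) ν x hxpos]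
    refine deriv_bound hm α hα μ N hN' C hCp x hxpos ?_ ?_ ν
    · rw [← hbP]
      have := hM0 _ hx.2
      have := le_abs_self (b (P x))
      have := le_abs_self M0
      simp only [Function.comp]
      linarith
    · intro j hj
      rw [← hbP, ← hP]
      refine (hkey _ hx.2 j hj).trans ?_
      have h1 : |M j| / |μ j| ≤ ∑ j, |M j| / |μ j| :=
        Finset.single_le_sum (f := fun j => |M j| / |μ j|) (fun _ _ => by positivity)
          (Finset.mem_univ j)
      have h2 : 0 ≤ P x j := by rw [hP]; positivity
      apply mul_le_mul_of_nonneg_right _ h2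
      have := abs_nonneg M0
      linarith
end
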